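/- Let (Z_x)_{x∈T} be a centered Gaussian vector on a finite set T, q ≥ 1, let M be a median of ‖Z‖_{2q} = (∑_x Z_x^{2q})^{1/(2q)}, and let ρ = sup{ Var(∑_x f_x Z_x) : ‖f‖_{(2q)'} = 1 }. If γ(1+ε) < 1/ρ for some ε > 0 and γ > 0, then E[ exp( (γ/2) ‖Z‖_{2q}² ) ] ≤ ( −1 + 2/√(1 − γ(1+ε)ρ) ) · exp( (γ/2)·((1+ε)/ε)·M² ). -/

import Mathlib

namespace GB
open MeasureTheory ProbabilityTheory Filter Topology Set

/-- standard normal density -/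
noncomputable def ph (x : ℝ) : ℝ := (√(2 * Real.pi))⁻¹ * Real.exp (-x ^ 2 / 2)

/-- standard normal distribution function -/
noncomputable def Ph (x : ℝ) : ℝ := (gaussianReal 0 1).real (Iic x)

lemma pdf_eq : gaussianPDFReal 0 1 = ph := by
  ext x; simp [gaussianPDFReal_def, ph]

lemma ph_pos (x : ℝ) : 0 < ph x := by unfold ph; positivity

lemma ph_le_one (x : ℝ) : ph x ≤ 1 := by
  unfold ph
  have h1 : Real.exp (-x ^ 2 / 2) ≤ 1 := Real.exp_le_one_iff.2 (by nlinarith [sq_nonneg x])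
  have h2 : (√(2 * Real.pi))⁻¹ ≤ 1 := by
    apply inv_le_one_of_one_le₀
    rw [Real.one_le_sqrt]
    nlinarith [Real.pi_gt_three]
  exact mul_le_one₀ h2 (Real.exp_pos _).le h1

lemma ph_neg (x : ℝ) : ph (-x) = ph x := by simp [ph]

lemma ph_contDiff : ContDiff ℝ ⊤ ph := by
  unfold ph; fun_prop

lemma ph_cont : Continuous ph := by unfold ph; fun_prop

lemma ph_le_of_sq {x y : ℝ} (h : x ^ 2 ≤ y ^ 2) : ph y ≤ ph x := by
  unfold ph
  gcongr

lemma hasDerivAt_ph (x : ℝ) : HasDerivAt ph (-x * ph x) x := by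
  have h : HasDerivAt (fun x : ℝ => -x ^ 2 / 2) (-x) x := by
    have := ((hasDerivAt_pow 2 x).neg.div_const 2)
    convert! this using 1; simp; ring
  have := (h.exp).const_mul (√(2 * Real.pi))⁻¹
  convert! this using 1; simp [ph]; ring

lemma integrable_ph : Integrable ph := pdf_eq ▸ integrable_gaussianPDFReal 0 1

lemma Ph_eq (x : ℝ) : Ph x = ∫ t in Iic x, ph t := by
  rw [Ph, measureReal_def, gaussianReal_apply_eq_integral 0 one_ne_zero, pdf_eq,
    ENNReal.toReal_ofReal]
  exact integral_nonneg fun t => (ph_pos t).le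

lemma hasDerivAt_Ph (x : ℝ) : HasDerivAt Ph (ph x) x := by
  have h : Ph = fun y => Ph 0 + ∫ t in (0:ℝ)..y, ph t := by
    ext y
    rw [← intervalIntegral.integral_Iic_sub_Iic integrable_ph.integrableOn
      integrable_ph.integrableOn, Ph_eq, Ph_eq]; ring
  rw [h]
  exact (intervalIntegral.integral_hasDerivAt_right integrable_ph.intervalIntegrable
    ph_cont.stronglyMeasurable.stronglyMeasurableAtFilter ph_cont.continuousAt).const_add _

lemma Ph_cont : Continuous Ph :=
  continuous_iff_continuousAt.2 fun x => (hasDerivAt_Ph x).continuousAt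

lemma Ph_strictMono : StrictMono Ph :=
  strictMono_of_deriv_pos fun x => by rw [(hasDerivAt_Ph x).deriv]; exact ph_pos x

lemma deriv_Ph : deriv Ph = ph := funext fun x => (hasDerivAt_Ph x).deriv

lemma Ph_contDiff : ContDiff ℝ 2 Ph := by
  rw [show (2 : WithTop ℕ∞) = 1 + 1 by norm_num, contDiff_succ_iff_deriv]
  refine ⟨fun x => (hasDerivAt_Ph x).differentiableAt, by simp, ?_⟩
  rw [deriv_Ph]; exact ph_contDiff.of_le le_top

lemma Ph_eq_cdf (x : ℝ) : Ph x = cdf (gaussianReal 0 1) x := (cdf_eq_real _ x).symm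

lemma Ph_atBot : Tendsto Ph atBot (𝓝 0) := by
  rw [show Ph = cdf (gaussianReal 0 1) from funext Ph_eq_cdf]
  exact tendsto_cdf_atBot (gaussianReal 0 1)

lemma Ph_atTop : Tendsto Ph atTop (𝓝 1) := by
  rw [show Ph = cdf (gaussianReal 0 1) from funext Ph_eq_cdf]
  exact tendsto_cdf_atTop (gaussianReal 0 1)

lemma Ph_pos (x : ℝ) : 0 < Ph x :=
  lt_of_le_of_lt measureReal_nonneg (Ph_strictMono (sub_one_lt x))

lemma Ph_lt_one (x : ℝ) : Ph x < 1 :=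
  lt_of_lt_of_le (Ph_strictMono (lt_add_one x)) measureReal_le_one

lemma gauss_Ici (x : ℝ) : (gaussianReal 0 1).real (Ici x) = Ph (-x) := by
  have h : (gaussianReal 0 1).map (fun x => -x) = gaussianReal 0 1 := by
    simpa using gaussianReal_map_neg (μ := 0) (v := 1)
  unfold Ph
  conv_rhs => rw [← h]
  rw [map_measureReal_apply (by fun_prop) measurableSet_Iic]
  congr 1; ext y; simp

lemma Ph_neg (x : ℝ) : Ph (-x) = 1 - Ph x := by
  have : NullSingletonClass (gaussianReal 0 1) := nullSingletonClass_gaussianReal one_ne_zero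
  have h1 := probReal_compl_eq_one_sub (μ := gaussianReal 0 1) (measurableSet_Iic (a := x))
  rw [compl_Iic] at h1
  rw [← gauss_Ici, Ph, ← h1]
  exact (measureReal_congr Ioi_ae_eq_Ici).symm

lemma Ph_zero : Ph 0 = 1 / 2 := by
  have := Ph_neg 0
  rw [neg_zero] at this; linarith

lemma Ph_surj {p : ℝ} (hp : p ∈ Ioo (0:ℝ) 1) : ∃ x, Ph x = p := by
  have h1 := (Ph_atBot.eventually_lt_const hp.1).exists
  have h2 := (Ph_atTop.eventually_const_lt hp.2).exists
  obtain ⟨a, ha⟩ := h1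
  obtain ⟨b, hb⟩ := h2
  exact mem_range_of_exists_le_of_exists_ge Ph_cont ⟨a, ha.le⟩ ⟨b, hb.le⟩

open Classical in
/-- quantile function -/
noncomputable def kk (p : ℝ) : ℝ := if h : p ∈ Ioo (0:ℝ) 1 then (Ph_surj h).choose else 0

lemma Ph_kk {p : ℝ} (hp : p ∈ Ioo (0:ℝ) 1) : Ph (kk p) = p := by
  rw [kk, dif_pos hp]; exact (Ph_surj hp).choose_spec

lemma Ph_mem (x : ℝ) : Ph x ∈ Ioo (0:ℝ) 1 := ⟨Ph_pos x, Ph_lt_one x⟩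

lemma kk_Ph (x : ℝ) : kk (Ph x) = x := Ph_strictMono.injective (Ph_kk (Ph_mem x))

lemma kk_strictMonoOn : StrictMonoOn kk (Ioo (0:ℝ) 1) := by
  intro a ha b hb hab
  rw [← Ph_strictMono.lt_iff_lt, Ph_kk ha, Ph_kk hb]; exact hab

lemma kk_continuousAt {p : ℝ} (hp : p ∈ Ioo (0:ℝ) 1) : ContinuousAt kk p := by
  refine kk_strictMonoOn.continuousAt_of_image_mem_nhds (Ioo_mem_nhds hp.1 hp.2) ?_
  have : kk '' Ioo 0 1 = univ := by
    ext x; simp only [mem_image, mem_univ, iff_true]; exact ⟨Ph x, Ph_mem x, kk_Ph x⟩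
  rw [this]; exact univ_mem

lemma hasDerivAt_kk {p : ℝ} (hp : p ∈ Ioo (0:ℝ) 1) : HasDerivAt kk (ph (kk p))⁻¹ p := by
  refine HasDerivAt.of_local_left_inverse (kk_continuousAt hp) (hasDerivAt_Ph _) (ph_pos _).ne' ?_
  filter_upwards [Ioo_mem_nhds hp.1 hp.2] with y hy using Ph_kk hy

/-- Gaussian isoperimetric profile -/
noncomputable def II (p : ℝ) : ℝ := ph (kk p)

lemma II_pos (p : ℝ) : 0 < II p := ph_pos _

lemma hasDerivAt_II {p : ℝ} (hp : p ∈ Ioo (0:ℝ) 1) : HasDerivAt II (-kk p) p := by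
  have := (hasDerivAt_ph (kk p)).comp p (hasDerivAt_kk hp)
  convert! this using 1
  field_simp [(ph_pos (kk p)).ne']

lemma kk_symm {p : ℝ} (hp : p ∈ Ioo (0:ℝ) 1) : kk (1 - p) = - kk p := by
  have : 1 - p = Ph (- kk p) := by rw [Ph_neg, Ph_kk hp]
  rw [this, kk_Ph]

lemma II_symm {p : ℝ} (hp : p ∈ Ioo (0:ℝ) 1) : II (1 - p) = II p := by
  rw [II, kk_symm hp, ph_neg, II]

/-- second-order comparison -/
lemma second_order {X : ℝ} (hX : 0 ≤ X) {m m1 m2 : ℝ → ℝ}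
    (h1 : ∀ y ∈ Icc 0 X, HasDerivAt m (m1 y) y) (h2 : ∀ y ∈ Icc 0 X, HasDerivAt m1 (m2 y) y)
    (h3 : ∀ y ∈ Icc 0 X, 0 ≤ m2 y) (h0 : m 0 = 0) (h10 : m1 0 = 0) : 0 ≤ m X := by
  have a1 : MonotoneOn m1 (Icc 0 X) :=
    monotoneOn_of_hasDerivWithinAt_nonneg (convex_Icc 0 X)
      (fun y hy => (h2 y hy).continuousAt.continuousWithinAt)
      (fun y hy => (h2 y (interior_subset hy)).hasDerivWithinAt)
      (fun y hy => h3 y (interior_subset hy))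
  have a2 : MonotoneOn m (Icc 0 X) :=
    monotoneOn_of_hasDerivWithinAt_nonneg (convex_Icc 0 X)
      (fun y hy => (h1 y hy).continuousAt.continuousWithinAt)
      (fun y hy => (h1 y (interior_subset hy)).hasDerivWithinAt)
      (fun y hy => by
        have := a1 (left_mem_Icc.2 hX) (interior_subset hy) (interior_subset hy).1
        rwa [h10] at this)
  have := a2 (left_mem_Icc.2 hX) (right_mem_Icc.2 hX) hX
  rwa [h0] at this

lemma hasDerivAt_J {p : ℝ} (hp : p ∈ Ioo (0:ℝ) 1) :
    HasDerivAt (fun p => II p ^ 2) (-2 * (II p * kk p)) p := by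
  have := (hasDerivAt_II hp).pow 2
  convert! this using 1; simp; ring

lemma hasDerivAt_J1 {p : ℝ} (hp : p ∈ Ioo (0:ℝ) 1) :
    HasDerivAt (fun p => -2 * (II p * kk p)) (2 * kk p ^ 2 - 2) p := by
  have := ((hasDerivAt_II hp).mul (hasDerivAt_kk hp)).const_mul (-2)
  convert! this using 1
  have := (II_pos p).ne'
  rw [← II]; field_simp; ring

lemma hasDerivAt_K {p : ℝ} (hp : p ∈ Ioo (0:ℝ) 1) :
    HasDerivAt (fun p => kk p ^ 2) (2 * kk p / II p) p := by
  have := (hasDerivAt_kk hp).pow 2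
  convert! this using 1; simp [II]; ring

lemma hasDerivAt_K1 {p : ℝ} (hp : p ∈ Ioo (0:ℝ) 1) :
    HasDerivAt (fun p => 2 * kk p / II p) (2 * (1 + kk p ^ 2) / II p ^ 2) p := by
  have h0 := (II_pos p).ne'
  have := ((hasDerivAt_kk hp).const_mul 2).div (hasDerivAt_II hp) h0
  convert! this using 1
  rw [← II]; field_simp; ring

lemma dplus {f : ℝ → ℝ} {f' c y : ℝ} (h : HasDerivAt f f' (c + y)) :
    HasDerivAt (fun y => f (c + y)) f' y := h.comp_const_add c y

lemma dminus {f : ℝ → ℝ} {f' c y : ℝ} (h : HasDerivAt f f' (c - y)) :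
    HasDerivAt (fun y => f (c - y)) (-f') y := h.comp_const_sub c y

/-- Bobkov's two point inequality, main case -/
lemma two_point_aux {c x : ℝ} (hx : 0 ≤ x) (hc : c ≤ 1 / 2) (h0 : 0 < c - x) :
    II c ≤ (√(II (c + x) ^ 2 + x ^ 2) + √(II (c - x) ^ 2 + x ^ 2)) / 2 := by
  have mp : ∀ y ∈ Icc 0 x, c + y ∈ Ioo (0:ℝ) 1 := fun y hy =>
    ⟨by linarith [hy.1, hy.2], by linarith [hy.1, hy.2]⟩
  have mm : ∀ y ∈ Icc 0 x, c - y ∈ Ioo (0:ℝ) 1 := fun y hy =>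
    ⟨by linarith [hy.1, hy.2], by linarith [hy.1, hy.2]⟩
  -- convexity of the square of the quantile function
  have hK : ∀ y ∈ Icc 0 x, 2 * kk c ^ 2 ≤ kk (c + y) ^ 2 + kk (c - y) ^ 2 := by
    intro y hy
    have := second_order (X := y) hy.1
      (m := fun z => kk (c + z) ^ 2 + kk (c - z) ^ 2 - 2 * kk c ^ 2)
      (m1 := fun z => 2 * kk (c + z) / II (c + z) + -(2 * kk (c - z) / II (c - z)))
      (m2 := fun z => 2 * (1 + kk (c + z) ^ 2) / II (c + z) ^ 2 +
        - -(2 * (1 + kk (c - z) ^ 2) / II (c - z) ^ 2))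
      (fun z hz => ((dplus (f := fun p => kk p ^ 2)
          (hasDerivAt_K (mp z ⟨hz.1, hz.2.trans hy.2⟩))).add
        (dminus (f := fun p => kk p ^ 2)
          (hasDerivAt_K (mm z ⟨hz.1, hz.2.trans hy.2⟩)))).sub_const _)
      (fun z hz => (dplus (f := fun p => 2 * kk p / II p)
          (hasDerivAt_K1 (mp z ⟨hz.1, hz.2.trans hy.2⟩))).add
        (dminus (f := fun p => 2 * kk p / II p)
          (hasDerivAt_K1 (mm z ⟨hz.1, hz.2.trans hy.2⟩))).neg)
      (fun z hz => by rw [neg_neg]; positivity) (by simp; ring) (by simp)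
    linarith
  -- monotonicity of the square of the quantile function
  have hKm : ∀ y ∈ Icc 0 x, kk (c + y) ^ 2 ≤ kk (c - y) ^ 2 := by
    intro y hy
    have e1 : kk (c - y) ≤ kk (c + y) :=
      kk_strictMonoOn.monotoneOn (mm y hy) (mp y hy) (by linarith [hy.1])
    have e2 : kk (c + y) ≤ - kk (c - y) := by
      rw [← kk_symm (mm y hy)]
      refine kk_strictMonoOn.monotoneOn (mp y hy) ?_ (by linarith)
      have := mm y hy
      exact ⟨by linarith [this.2], by linarith [this.1]⟩
    exact sq_le_sq' (by linarith) e2 |>.trans (by simp)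
  set g0 := II c ^ 2 with hg0
  set h := II (c + x) ^ 2 + II (c - x) ^ 2 - 2 * g0 + 2 * x ^ 2 with hh
  have hx' : x ∈ Icc 0 x := ⟨hx, le_rfl⟩
  have H1 : 2 * kk c ^ 2 * x ^ 2 ≤ h := by
    have := second_order (X := x) hx
      (m := fun z => (II (c + z) ^ 2 + II (c - z) ^ 2) - 2 * g0 + (2 - 2 * kk c ^ 2) * z ^ 2)
      (m1 := fun z => -2 * (II (c + z) * kk (c + z)) + -(-2 * (II (c - z) * kk (c - z))) +
        (2 - 2 * kk c ^ 2) * (2 * z))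
      (m2 := fun z => (2 * kk (c + z) ^ 2 - 2) + - -(2 * kk (c - z) ^ 2 - 2) +
        (2 - 2 * kk c ^ 2) * (2 * 1))
      (fun z hz => (((dplus (f := fun p => II p ^ 2) (hasDerivAt_J (mp z hz))).add
        (dminus (f := fun p => II p ^ 2) (hasDerivAt_J (mm z hz)))).sub_const _).add
        ((by simpa using (hasDerivAt_pow 2 z) : HasDerivAt (fun z : ℝ => z ^ 2) (2 * z) z).const_mul _))
      (fun z hz => ((dplus (f := fun p => -2 * (II p * kk p)) (hasDerivAt_J1 (mp z hz))).add
        (dminus (f := fun p => -2 * (II p * kk p)) (hasDerivAt_J1 (mm z hz))).neg).add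
        (((hasDerivAt_id z).const_mul 2).const_mul _))
      (fun z hz => by have := hK z hz; linarith) (by simp [hg0]; ring) (by simp)
    rw [hh]; linarith
  have H2 : II (c + x) ^ 2 - II (c - x) ^ 2 ≤ -4 * (II c * kk c) * x := by
    have := second_order (X := x) hx
      (m := fun z => -4 * (II c * kk c) * z - (II (c + z) ^ 2 - II (c - z) ^ 2))
      (m1 := fun z => -4 * (II c * kk c) * 1 - (-2 * (II (c + z) * kk (c + z))
        - -(-2 * (II (c - z) * kk (c - z)))))
      (m2 := fun z => -((2 * kk (c + z) ^ 2 - 2) - - -(2 * kk (c - z) ^ 2 - 2)))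
      (fun z hz => ((hasDerivAt_id z).const_mul _).sub
        ((dplus (f := fun p => II p ^ 2) (hasDerivAt_J (mp z hz))).sub
        (dminus (f := fun p => II p ^ 2) (hasDerivAt_J (mm z hz)))))
      (fun z hz => ((dplus (f := fun p => -2 * (II p * kk p)) (hasDerivAt_J1 (mp z hz))).sub
        (dminus (f := fun p => -2 * (II p * kk p)) (hasDerivAt_J1 (mm z hz))).neg).const_sub _)
      (fun z hz => by have := hKm z hz; linarith) (by simp) (by simp; ring)
    linarith
  have H3 : 0 ≤ II (c + x) ^ 2 - II (c - x) ^ 2 := by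
    have := ph_le_of_sq (hKm x hx')
    rw [sub_nonneg]
    exact pow_le_pow_left₀ (II_pos _).le this 2
  have H4 : (II (c + x) ^ 2 - II (c - x) ^ 2) ^ 2 ≤ 8 * g0 * h := by
    calc (II (c + x) ^ 2 - II (c - x) ^ 2) ^ 2 ≤ (-4 * (II c * kk c) * x) ^ 2 :=
          pow_le_pow_left₀ H3 H2 2
      _ = 8 * g0 * (2 * kk c ^ 2 * x ^ 2) := by rw [hg0]; ring
      _ ≤ 8 * g0 * h := by gcongr
  set A := II (c + x) ^ 2 + x ^ 2 with hA
  set B := II (c - x) ^ 2 + x ^ 2 with hB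
  have hA0 : 0 ≤ A := by positivity
  have hB0 : 0 ≤ B := by positivity
  have hAB : A + B = h + 2 * g0 := by rw [hh, hA, hB]; ring
  have hABd : (A - B) ^ 2 ≤ 8 * g0 * h := by
    have : A - B = II (c + x) ^ 2 - II (c - x) ^ 2 := by rw [hA, hB]; ring
    rwa [this]
  have hsq : (2 * g0 - h) ^ 2 ≤ (2 * (√A * √B)) ^ 2 := by
    have e : (2 * (√A * √B)) ^ 2 = 4 * A * B := by
      rw [mul_pow, mul_pow, Real.sq_sqrt hA0, Real.sq_sqrt hB0]; ring
    rw [e]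
    nlinarith
  have h5 : 2 * g0 - h ≤ 2 * (√A * √B) := abs_le_of_sq_le_sq' hsq (by positivity) |>.2
  have h6 : (2 * II c) ^ 2 ≤ (√A + √B) ^ 2 := by
    have : (√A + √B) ^ 2 = A + B + 2 * (√A * √B) := by
      rw [add_sq, Real.sq_sqrt hA0, Real.sq_sqrt hB0]; ring
    rw [this, hAB, mul_pow, ← hg0]; linarith
  have h7 := abs_le_of_sq_le_sq' h6 (by positivity) |>.2
  linarith

lemma two_point_aux2 {c x : ℝ} (hx : 0 ≤ x) (h0 : 0 < c - x) (h1 : c + x < 1) :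
    II c ≤ (√(II (c + x) ^ 2 + x ^ 2) + √(II (c - x) ^ 2 + x ^ 2)) / 2 := by
  rcases le_total c (1 / 2) with hc | hc
  · exact two_point_aux hx hc h0
  · have := two_point_aux (c := 1 - c) hx (by linarith) (by linarith)
    rw [II_symm ⟨by linarith, by linarith⟩, show 1 - c + x = 1 - (c - x) by ring,
      show 1 - c - x = 1 - (c + x) by ring, II_symm ⟨by linarith, by linarith⟩,
      II_symm ⟨by linarith, by linarith⟩] at this
    linarith

/-- Bobkov's two point inequality -/
lemma two_point {a b : ℝ} (ha : a ∈ Ioo (0:ℝ) 1) (hb : b ∈ Ioo (0:ℝ) 1) :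
    II ((a + b) / 2) ≤ (√(II a ^ 2 + ((a - b) / 2) ^ 2) + √(II b ^ 2 + ((a - b) / 2) ^ 2)) / 2 := by
  rcases le_total b a with h | h
  · have := two_point_aux2 (c := (a + b) / 2) (x := (a - b) / 2) (by linarith)
      (by linarith [hb.1]) (by linarith [ha.2])
    rwa [show (a + b) / 2 + (a - b) / 2 = a by ring,
      show (a + b) / 2 - (a - b) / 2 = b by ring] at this
  · have := two_point_aux2 (c := (a + b) / 2) (x := (b - a) / 2) (by linarith)
      (by linarith [ha.1]) (by linarith [hb.2])
    rw [show (a + b) / 2 + (b - a) / 2 = b by ring,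
      show (a + b) / 2 - (b - a) / 2 = a by ring,
      show ((b - a) / 2) ^ 2 = ((a - b) / 2) ^ 2 by ring] at this
    linarith

end GB
namespace GB
set_option linter.unusedSectionVars false
open MeasureTheory ProbabilityTheory Filter Topology Set

lemma mink2 (a b c d : ℝ) :
    √(((a + b) / 2) ^ 2 + ((c + d) / 2) ^ 2) ≤ (√(a ^ 2 + c ^ 2) + √(b ^ 2 + d ^ 2)) / 2 := by
  have hA : 0 ≤ a ^ 2 + c ^ 2 := by positivity
  have hB : 0 ≤ b ^ 2 + d ^ 2 := by positivity
  have h1 : a * b + c * d ≤ √(a ^ 2 + c ^ 2) * √(b ^ 2 + d ^ 2) := by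
    refine (abs_le_of_sq_le_sq' ?_ (by positivity)).2
    rw [mul_pow, Real.sq_sqrt hA, Real.sq_sqrt hB]
    nlinarith [sq_nonneg (a * d - b * c)]
  rw [Real.sqrt_le_left (by positivity)]
  have h2 := Real.sq_sqrt hA
  have h3 := Real.sq_sqrt hB
  nlinarith

section disc
variable {E : Type*} [NormedAddCommGroup E] [InnerProductSpace ℝ E]

/-- expectation over a random sign walk -/
noncomputable def Ex : List E → (E → ℝ) → E → ℝ
  | [], f, x => f x
  | v :: l, f, x => (Ex l f (x + v) + Ex l f (x - v)) / 2

lemma Ex_mono (l : List E) {f g : E → ℝ} (h : ∀ y, f y ≤ g y) (x : E) : Ex l f x ≤ Ex l g x := by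
  induction l generalizing x with
  | nil => exact h x
  | cons v l ih => simp only [Ex]; linarith [ih (x + v), ih (x - v)]

lemma Ex_mem (l : List E) {f : E → ℝ} (h : ∀ y, f y ∈ Ioo (0:ℝ) 1) (x : E) :
    Ex l f x ∈ Ioo (0:ℝ) 1 := by
  induction l generalizing x with
  | nil => exact h x
  | cons v l ih =>
    have h1 := ih (x + v)
    have h2 := ih (x - v)
    simp only [Ex]; exact ⟨by linarith [h1.1, h2.1], by linarith [h1.2, h2.2]⟩

lemma Ex_add_const (l : List E) (f : E → ℝ) (c : ℝ) (x : E) :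
    Ex l (fun y => f y + c) x = Ex l f x + c := by
  induction l generalizing x with
  | nil => rfl
  | cons v l ih => simp only [Ex, ih]; ring

lemma Ex_mink (l : List E) (u w : E → ℝ) (x : E) :
    √(Ex l u x ^ 2 + Ex l w x ^ 2) ≤ Ex l (fun y => √(u y ^ 2 + w y ^ 2)) x := by
  induction l generalizing x with
  | nil => exact le_rfl
  | cons v l ih =>
    simp only [Ex]
    refine (mink2 _ _ _ _).trans ?_
    linarith [ih (x + v), ih (x - v)]

/-- differences of walks -/
lemma Ex_diff (l : List E) (f w : E → ℝ) (z : E) (h : ∀ y, |f y - f (y + z)| / 2 ≤ w y) (x : E) :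
    |Ex l f x - Ex l f (x + z)| / 2 ≤ Ex l w x := by
  induction l generalizing x with
  | nil => exact h x
  | cons v l ih =>
    simp only [Ex]
    have h1 := ih (x + v)
    have h2 := ih (x - v)
    rw [show x + v + z = x + z + v by abel] at h1
    rw [show x - v + z = x + z - v by abel] at h2
    have h3 := abs_add_le (Ex l f (x + v) - Ex l f (x + z + v)) (Ex l f (x - v) - Ex l f (x + z - v))
    rw [show (Ex l f (x + v) + Ex l f (x - v)) / 2 - (Ex l f (x + z + v) + Ex l f (x + z - v)) / 2
      = ((Ex l f (x + v) - Ex l f (x + z + v)) + (Ex l f (x - v) - Ex l f (x + z - v))) / 2 by ring,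
      abs_div, abs_two]
    linarith

/-- Bobkov's inequality on the discrete cube -/
lemma bobkov_disc (f : E → ℝ) (hf : ∀ y, f y ∈ Ioo (0:ℝ) 1) (b : E → E → ℝ)
    (hp : ∀ v y, |f y - f (y + (v + v))| / 2 ≤ b v y)
    (hm : ∀ v y, |f y - f (y + -(v + v))| / 2 ≤ b v y) (l : List E) (x : E) :
    II (Ex l f x) ≤ Ex l (fun y => √(II (f y) ^ 2 + (l.map (fun v => b v y ^ 2)).sum)) x := by
  induction l generalizing x with
  | nil => simp [Ex, Real.sqrt_sq (II_pos _).le]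
  | cons v l ih =>
    simp only [Ex]
    refine (two_point (Ex_mem l hf _) (Ex_mem l hf _)).trans ?_
    have key : ∀ x' d : ℝ, ∀ z : E, |d| ≤ Ex l (b v) z →
        √(II (Ex l f z) ^ 2 + d ^ 2) ≤
        Ex l (fun y => √(II (f y) ^ 2 + ((v :: l).map (fun v => b v y ^ 2)).sum)) z := by
      intro _ d z hd
      have e1 : II (Ex l f z) ^ 2 ≤
          (Ex l (fun y => √(II (f y) ^ 2 + (l.map (fun v => b v y ^ 2)).sum)) z) ^ 2 :=
        pow_le_pow_left₀ (II_pos _).le (ih z) 2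
      have e2 : d ^ 2 ≤ (Ex l (b v) z) ^ 2 := by
        rw [← sq_abs d]; exact pow_le_pow_left₀ (abs_nonneg _) hd 2
      refine (Real.sqrt_le_sqrt (add_le_add e1 e2)).trans ((Ex_mink l _ _ z).trans ?_)
      refine Ex_mono l (fun y => ?_) z
      have : 0 ≤ (l.map (fun v => b v y ^ 2)).sum :=
        List.sum_nonneg (by simp only [List.mem_map]; rintro _ ⟨v, _, rfl⟩; positivity)
      rw [Real.sq_sqrt (by positivity), List.map_cons, List.sum_cons]
      apply Real.sqrt_le_sqrt
      linarith
    have d1 := Ex_diff l f (b v) (-(v + v)) (hm v) (x + v)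
    have d2 := Ex_diff l f (b v) (v + v) (hp v) (x - v)
    rw [show x + v + -(v + v) = x - v by abel] at d1
    rw [show x - v + (v + v) = x + v by abel, abs_sub_comm] at d2
    have k1 := key 0 ((Ex l f (x + v) - Ex l f (x - v)) / 2) (x + v)
      (by rw [abs_div, abs_two]; exact d1)
    have k2 := key 0 ((Ex l f (x + v) - Ex l f (x - v)) / 2) (x - v)
      (by rw [abs_div, abs_two]; exact d2)
    linarith

variable [MeasurableSpace E] [BorelSpace E]

/-- law of the random sign walk -/
noncomputable def mu : List E → E → Measure E
  | [], x => Measure.dirac x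
  | v :: l, x => (2⁻¹ : ENNReal) • mu l (x + v) + (2⁻¹ : ENNReal) • mu l (x - v)

instance mu_prob (l : List E) (x : E) : IsProbabilityMeasure (mu l x) := by
  induction l generalizing x with
  | nil => simp only [mu]; infer_instance
  | cons v l ih =>
    have := ih (x + v)
    have := ih (x - v)
    constructor
    simp [mu, ENNReal.inv_two_add_inv_two]

lemma mu_integrable {F : Type*} [NormedAddCommGroup F] (l : List E) (x : E) {f : E → F}
    (hf : StronglyMeasurable f) : Integrable f (mu l x) := by
  induction l generalizing x with
  | nil => exact (integrable_dirac' hf (by simp))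
  | cons v l ih =>
    exact ((ih _).smul_measure (by simp)).add_measure ((ih _).smul_measure (by simp))

lemma mu_integral_cons {F : Type*} [NormedAddCommGroup F] [NormedSpace ℝ F]
    (v : E) (l : List E) (x : E) {f : E → F} (hf : StronglyMeasurable f) :
    ∫ y, f y ∂(mu (v :: l) x) =
      (2⁻¹ : ℝ) • (∫ y, f y ∂(mu l (x + v)) + ∫ y, f y ∂(mu l (x - v))) := by
  rw [mu, integral_add_measure ((mu_integrable _ _ hf).smul_measure (by simp))
    ((mu_integrable _ _ hf).smul_measure (by simp)), integral_smul_measure, integral_smul_measure]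
  simp

lemma mu_integral (l : List E) (x : E) {f : E → ℝ} (hf : StronglyMeasurable f) :
    ∫ y, f y ∂(mu l x) = Ex l f x := by
  induction l generalizing x with
  | nil => simp only [mu, Ex]; exact integral_dirac' _ _ hf
  | cons v l ih =>
    rw [mu_integral_cons v l x hf, ih, ih, Ex, smul_eq_mul]; ring

lemma mu_charFun [SecondCountableTopology E] (l : List E) (x t : E) :
    charFun (mu l x) t = Complex.exp (inner ℝ x t * Complex.I) *
      ((l.map (fun v => Real.cos (inner ℝ v t))).prod : ℝ) := by
  have hm : StronglyMeasurable (fun y : E => Complex.exp (inner ℝ y t * Complex.I)) := by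
    apply Continuous.stronglyMeasurable; fun_prop
  induction l generalizing x with
  | nil => simp only [charFun_apply, mu]; rw [integral_dirac' _ _ hm]; simp
  | cons v l ih =>
    rw [charFun_apply, mu_integral_cons v l x hm, ← charFun_apply, ← charFun_apply, ih, ih]
    rw [List.map_cons, List.prod_cons, inner_add_left, inner_sub_left]
    push_cast
    rw [add_mul, sub_mul, Complex.exp_add, Complex.exp_sub, Complex.cos]
    rw [Complex.real_smul, neg_mul, Complex.exp_neg]
    push_cast
    ring

end disc
end GB
namespace GB
open MeasureTheory ProbabilityTheory Filter Topology Set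

lemma cos_lim (s : ℝ) :
    Tendsto (fun n : ℕ => Real.cos ((√n)⁻¹ * s) ^ n) atTop (𝓝 (Real.exp (-s ^ 2 / 2))) := by
  have h : Tendsto (fun n : ℕ => (n : ℝ) * (Real.cos ((√n)⁻¹ * s) - 1)) atTop (𝓝 (-s ^ 2 / 2)) := by
    have hz : Tendsto (fun n : ℕ => (√n)⁻¹ * s) atTop (𝓝 0) := by
      have : Tendsto (fun n : ℕ => (√(n:ℝ))⁻¹) atTop (𝓝 0) :=
        tendsto_inv_atTop_zero.comp (Real.tendsto_sqrt_atTop.comp tendsto_natCast_atTop_atTop)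
      simpa using this.mul_const s
    have hb : Tendsto (fun n : ℕ => (5 / 96 * s ^ 4) * (n:ℝ)⁻¹) atTop (𝓝 0) := by
      simpa using (tendsto_inv_atTop_nhds_zero_nat (𝕜 := ℝ)).const_mul (5 / 96 * s ^ 4)
    rw [tendsto_iff_norm_sub_tendsto_zero]
    refine squeeze_zero' (Eventually.of_forall fun _ => norm_nonneg _) ?_ hb
    filter_upwards [hz.eventually (Metric.ball_mem_nhds 0 one_pos), eventually_gt_atTop 0] with n hn hn0
    have hn1 : |(√n)⁻¹ * s| ≤ 1 := by simpa using (le_of_lt hn)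
    have := Real.cos_bound hn1
    have hnp : (0:ℝ) < n := by exact_mod_cast hn0
    have e2 : ((√(n:ℝ))⁻¹ * s) ^ 2 = (n:ℝ)⁻¹ * s ^ 2 := by
      rw [mul_pow, inv_pow, Real.sq_sqrt hnp.le]
    have e4 : |(√(n:ℝ))⁻¹ * s| ^ 4 = ((n:ℝ)⁻¹) ^ 2 * s ^ 4 := by
      rw [show (4:ℕ) = 2 * 2 by norm_num, pow_mul, sq_abs, e2]; ring
    rw [e2, e4] at this
    rw [Real.norm_eq_abs, show (n:ℝ) * (Real.cos ((√n)⁻¹ * s) - 1) - -s ^ 2 / 2 =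
      n * (Real.cos ((√n)⁻¹ * s) - (1 - (n:ℝ)⁻¹ * s ^ 2 / 2)) by field_simp; ring, abs_mul,
      abs_of_pos hnp]
    calc (n:ℝ) * |Real.cos ((√n)⁻¹ * s) - (1 - (n:ℝ)⁻¹ * s ^ 2 / 2)|
        ≤ n * (((n:ℝ)⁻¹) ^ 2 * s ^ 4 * (5 / 96)) := by gcongr
      _ = 5 / 96 * s ^ 4 * (n:ℝ)⁻¹ := by field_simp
  simpa using Real.tendsto_one_add_pow_exp_of_tendsto h

set_option linter.unusedSectionVars false
section gauss
variable {E : Type*} [NormedAddCommGroup E] [InnerProductSpace ℝ E] [FiniteDimensional ℝ E]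
  [MeasurableSpace E] [BorelSpace E] {ι : Type*} [Fintype ι]

/-- steps of the walk -/
noncomputable def steps (b : OrthonormalBasis ι ℝ E) (n : ℕ) : List E :=
  (List.replicate n (Finset.univ.toList.map (fun i : ι => (√(n:ℝ))⁻¹ • b i))).flatten

lemma steps_sum (b : OrthonormalBasis ι ℝ E) (n : ℕ) (g : E → ℝ) :
    ((steps b n).map g).sum = n * ∑ i, g ((√(n:ℝ))⁻¹ • b i) := by
  rw [steps, List.map_flatten, List.sum_flatten, List.map_replicate, List.map_replicate,
    List.sum_replicate, List.map_map, nsmul_eq_mul, ← Finset.sum_map_toList]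
  rfl

lemma steps_prod (b : OrthonormalBasis ι ℝ E) (n : ℕ) (g : E → ℝ) :
    ((steps b n).map g).prod = ∏ i, g ((√(n:ℝ))⁻¹ • b i) ^ n := by
  rw [steps, List.map_flatten, List.prod_flatten, List.map_replicate, List.map_replicate,
    List.prod_replicate, List.map_map, Finset.prod_pow, ← Finset.prod_map_toList]
  rfl

lemma walk_tendsto (b : OrthonormalBasis ι ℝ E) (f : E → ℝ) (hf : Continuous f) (C : ℝ)
    (hC : ∀ y, |f y| ≤ C) :
    Tendsto (fun n => Ex (steps b n) f 0) atTop (𝓝 (∫ y, f y ∂(stdGaussian E))) := by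
  let μs : ℕ → ProbabilityMeasure E := fun n => ⟨mu (steps b n) 0, inferInstance⟩
  let μ0 : ProbabilityMeasure E := ⟨stdGaussian E, inferInstance⟩
  have h : Tendsto μs atTop (𝓝 μ0) := by
    rw [ProbabilityMeasure.tendsto_iff_tendsto_charFun]
    intro t
    change Tendsto (fun n => charFun (mu (steps b n) 0) t) atTop (𝓝 (charFun (stdGaussian E) t))
    simp only [mu_charFun, charFun_stdGaussian, steps_prod]
    have := tendsto_finsetProd (Finset.univ : Finset ι) (fun i _ => cos_lim (inner ℝ (b i) t))
    rw [← Real.exp_sum] at this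
    have e : ∑ i, -(inner ℝ (b i) t) ^ 2 / 2 = -‖t‖ ^ 2 / 2 := by
      rw [← b.sum_sq_norm_inner_right t, ← Finset.sum_div, Finset.sum_neg_distrib]
      simp
    rw [e] at this
    have h2 := (Complex.continuous_ofReal.tendsto _).comp this
    simp only [Function.comp_def] at h2
    convert! h2 using 2
    · simp [inner_smul_left]
    · push_cast; rfl
  rw [ProbabilityMeasure.tendsto_iff_forall_integral_tendsto] at h
  have := h (BoundedContinuousFunction.ofNormedAddCommGroup f hf C (fun y => by simpa using hC y))
  change Tendsto (fun n => ∫ y, f y ∂(mu (steps b n) 0)) atTop (𝓝 (∫ y, f y ∂(stdGaussian E))) at this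
  simpa only [mu_integral _ _ hf.stronglyMeasurable] using this

lemma sqrt_err (I2 ε : ℝ) (hI : 0 ≤ I2) (hε : 0 ≤ ε) (a : ι → ℝ) (ha : ∀ i, 0 ≤ a i) :
    √(I2 + ∑ i, (a i + ε) ^ 2) ≤ √(I2 + ∑ i, a i ^ 2) + Fintype.card ι * ε := by
  have h0 : 0 ≤ I2 + ∑ i, a i ^ 2 := by positivity
  rw [Real.sqrt_le_left (by positivity), add_sq, Real.sq_sqrt h0]
  have h1 : ∀ i, a i ≤ √(I2 + ∑ i, a i ^ 2) := by
    intro i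
    apply Real.le_sqrt_of_sq_le
    have := Finset.single_le_sum (f := fun i => a i ^ 2) (fun j _ => sq_nonneg (a j))
      (Finset.mem_univ i)
    linarith
  have h2 : ∑ i, (a i + ε) ^ 2 = ∑ i, a i ^ 2 + 2 * ε * ∑ i, a i + Fintype.card ι * ε ^ 2 := by
    simp only [add_sq, Finset.sum_add_distrib, Finset.mul_sum]
    simp only [Finset.sum_const, Finset.card_univ, nsmul_eq_mul]
    congr 2
    apply Finset.sum_congr rfl; intros; ring
  have h3 : ∑ i, a i ≤ Fintype.card ι * √(I2 + ∑ i, a i ^ 2) := by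
    have := Finset.sum_le_card_nsmul Finset.univ a _ (fun i _ => h1 i)
    simpa using this
  have h4 : (Fintype.card ι : ℝ) ≤ (Fintype.card ι : ℝ) ^ 2 := by
    have : Fintype.card ι ≤ Fintype.card ι ^ 2 := Nat.le_self_pow two_ne_zero _
    exact_mod_cast this
  rw [h2]
  have h5 := mul_le_mul_of_nonneg_left h3 (by positivity : 0 ≤ 2 * ε)
  have h6 := mul_le_mul_of_nonneg_right h4 (sq_nonneg ε)
  nlinarith

lemma II_cont : ContinuousOn II (Ioo (0:ℝ) 1) := fun _ hp =>
  (hasDerivAt_II hp).continuousAt.continuousWithinAt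

/-- Bobkov's inequality for the Gaussian measure -/
lemma bobkov_gauss (b : OrthonormalBasis ι ℝ E) (f : E → ℝ) (hf : ∀ y, f y ∈ Ioo (0:ℝ) 1)
    (hd : Differentiable ℝ f) (K : NNReal) (hK : LipschitzWith K (fderiv ℝ f)) (C : ℝ)
    (hC : ∀ y, ‖fderiv ℝ f y‖ ≤ C) (hInteg : ∫ y, f y ∂(stdGaussian E) ∈ Ioo (0:ℝ) 1) :
    II (∫ y, f y ∂(stdGaussian E)) ≤
      ∫ y, √(II (f y) ^ 2 + ∑ i, |fderiv ℝ f y (b i)| ^ 2) ∂(stdGaussian E) := by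
  have hC0 : 0 ≤ C := (norm_nonneg _).trans (hC 0)
  have hcf : Continuous f := hd.continuous
  have hcf' : Continuous (fderiv ℝ f) := hK.continuous
  have hIf : Continuous (fun y => II (f y)) := II_cont.comp_continuous hcf hf
  have hcg : Continuous (fun y => √(II (f y) ^ 2 + ∑ i, |fderiv ℝ f y (b i)| ^ 2)) := by
    fun_prop
  have t1 := walk_tendsto b f hcf 1 (fun y => by
    rw [abs_of_pos (hf y).1]; exact (hf y).2.le)
  have t2 := walk_tendsto b _ hcg (√(1 + ∑ i : ι, C ^ 2)) (fun y => by
    rw [abs_of_nonneg (Real.sqrt_nonneg _)]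
    apply Real.sqrt_le_sqrt
    gcongr with i
    · exact pow_le_one₀ (II_pos _).le (ph_le_one _)
    · have := (fderiv ℝ f y).le_opNorm (b i)
      rw [b.norm_eq_one, mul_one] at this
      exact this.trans (hC y))
  have t3 : Tendsto (fun n : ℕ => (Fintype.card ι : ℝ) * (2 * K * (√(n:ℝ))⁻¹)) atTop (𝓝 0) := by
    have : Tendsto (fun n : ℕ => (√(n:ℝ))⁻¹) atTop (𝓝 0) :=
      tendsto_inv_atTop_zero.comp (Real.tendsto_sqrt_atTop.comp tendsto_natCast_atTop_atTop)
    simpa using (this.const_mul (2 * (K:ℝ))).const_mul (Fintype.card ι : ℝ)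
  have t4 := ((hasDerivAt_II hInteg).continuousAt.tendsto).comp t1
  have t5 := t2.add t3
  rw [add_zero] at t5
  refine le_of_tendsto_of_tendsto t4 t5 ?_
  filter_upwards [eventually_gt_atTop 0] with n hn
  have hnp : (0:ℝ) < n := by exact_mod_cast hn
  -- Taylor
  have taylor : ∀ w y : E, |f y - f (y + w)| / 2 ≤ |fderiv ℝ f y w| / 2 + K * ‖w‖ ^ 2 / 2 := by
    intro w y
    have := (convex_segment y (y + w)).norm_image_sub_le_of_norm_hasFDerivWithin_le'
      (f := f) (f' := fderiv ℝ f) (φ := fderiv ℝ f y) (C := K * ‖w‖)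
      (fun z _ => (hd z).hasFDerivAt.hasFDerivWithinAt) (fun z hz => by
        rw [← dist_eq_norm]
        refine (hK.dist_le_mul z y).trans ?_
        gcongr
        obtain ⟨θ, hθ, rfl⟩ := (segment_eq_image' ℝ y (y + w)) ▸ hz
        simp only [add_sub_cancel_left, dist_self_add_left, norm_smul, Real.norm_eq_abs]
        rw [abs_of_nonneg hθ.1]
        exact mul_le_of_le_one_left (norm_nonneg _) hθ.2)
      (left_mem_segment ℝ y (y + w)) (right_mem_segment ℝ y (y + w))
    rw [add_sub_cancel_left, Real.norm_eq_abs] at this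
    have h2 : |f y - f (y + w)| ≤ |f (y + w) - f y - fderiv ℝ f y w| + |fderiv ℝ f y w| := by
      have := abs_add_le (f (y + w) - f y - fderiv ℝ f y w) (fderiv ℝ f y w)
      rw [sub_add_cancel] at this
      rwa [abs_sub_comm]
    nlinarith
  have taylor2 : ∀ v y : E, |fderiv ℝ f y (v + v)| / 2 + K * ‖v + v‖ ^ 2 / 2 =
      |fderiv ℝ f y v| + 2 * K * ‖v‖ ^ 2 := by
    intro v y
    rw [← two_smul ℝ v, map_smul, norm_smul, smul_eq_mul, abs_mul, abs_two, Real.norm_eq_abs, abs_two]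
    ring
  have := bobkov_disc f hf (fun v y => |fderiv ℝ f y v| + 2 * K * ‖v‖ ^ 2)
    (fun v y => (taylor _ y).trans_eq (taylor2 v y))
    (fun v y => (taylor _ y).trans_eq (by rw [map_neg, abs_neg, norm_neg]; exact taylor2 v y))
    (steps b n) 0
  simp only [Function.comp_apply]
  refine this.trans ?_
  rw [← Ex_add_const]
  refine Ex_mono _ (fun y => ?_) _
  rw [steps_sum]
  refine le_trans (le_of_eq ?_) (sqrt_err (II (f y) ^ 2) (2 * K * (√(n:ℝ))⁻¹) (by positivity)
    (by positivity) (fun i => |fderiv ℝ f y (b i)|) (fun i => abs_nonneg _))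
  congr 2
  rw [Finset.mul_sum]
  apply Finset.sum_congr rfl
  intro i _
  rw [map_smul, norm_smul, b.norm_eq_one, smul_eq_mul, abs_mul, Real.norm_eq_abs,
    abs_of_nonneg (by positivity : 0 ≤ (√(n:ℝ))⁻¹)]
  have hs : (n:ℝ) * ((√(n:ℝ))⁻¹) ^ 2 = 1 := by
    rw [inv_pow, Real.sq_sqrt hnp.le, mul_inv_cancel₀ hnp.ne']
  linear_combination (|fderiv ℝ f y (b i)| + 2 * K * (√(n:ℝ))⁻¹) ^ 2 * hs

end gauss
end GB
namespace GB
open MeasureTheory ProbabilityTheory Filter Topology Set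
set_option linter.unusedSectionVars false
section gauss2
variable {E : Type*} [NormedAddCommGroup E] [InnerProductSpace ℝ E] [FiniteDimensional ℝ E]
  [MeasurableSpace E] [BorelSpace E] {ι : Type*} [Fintype ι]

lemma sum_dual (b : OrthonormalBasis ι ℝ E) (l : E →L[ℝ] ℝ) :
    ∑ i, |l (b i)| ^ 2 = ‖l‖ ^ 2 := by
  have := b.sum_sq_norm_inner_left ((InnerProductSpace.toDual ℝ E).symm l)
  simpa using this

lemma integral_mem {f : E → ℝ} (hf : Continuous f) (h : ∀ y, f y ∈ Ioo (0:ℝ) 1) :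
    Integrable f (stdGaussian E) ∧ ∫ y, f y ∂(stdGaussian E) ∈ Ioo (0:ℝ) 1 := by
  have hi : Integrable f (stdGaussian E) := by
    refine Integrable.of_bound hf.aestronglyMeasurable 1 (Eventually.of_forall fun y => ?_)
    rw [Real.norm_eq_abs, abs_of_pos (h y).1]; exact (h y).2.le
  have pos : ∀ g : E → ℝ, (∀ y, 0 < g y) → Integrable g (stdGaussian E) →
      0 < ∫ y, g y ∂(stdGaussian E) := by
    intro g hg hgi
    rw [integral_pos_iff_support_of_nonneg (fun y => (hg y).le) hgi]
    rw [show Function.support g = univ from eq_univ_of_forall fun y => (hg y).ne']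
    simp
  refine ⟨hi, pos f (fun y => (h y).1) hi, ?_⟩
  have := pos (fun y => 1 - f y) (fun y => sub_pos.2 (h y).2) ((integrable_const _).sub hi)
  rw [integral_sub (integrable_const _) hi] at this
  simp at this
  exact this

lemma slope (b : OrthonormalBasis ι ℝ E) (g : E → ℝ) (hg : ContDiff ℝ 2 g) (c : ℝ)
    (hc : HasCompactSupport (fun y => g y - c)) (hl : ∀ y, ‖fderiv ℝ g y‖ ≤ 1)
    {η : ℝ} (hη : 0 < η) (s u : ℝ) (hu : 0 ≤ u) :
    kk (∫ y, Ph ((g y - (s + u)) / η) ∂(stdGaussian E)) ≤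
      kk (∫ y, Ph ((g y - s) / η) ∂(stdGaussian E)) - (√(1 + η ^ 2))⁻¹ * u := by
  have hgc := hg.continuous
  set v : ℝ → ℝ := fun s => ∫ y, Ph ((g y - s) / η) ∂(stdGaussian E) with hv
  have hcont : ∀ s, Continuous (fun y => Ph ((g y - s) / η)) := fun s =>
    Ph_cont.comp (by fun_prop)
  have hcont' : ∀ s, Continuous (fun y => ph ((g y - s) / η)) := fun s =>
    ph_cont.comp (by fun_prop)
  have hvm : ∀ s, v s ∈ Ioo (0:ℝ) 1 := fun s => (integral_mem (hcont s) (fun y => Ph_mem _)).2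
  have hvd : ∀ s, HasDerivAt v (∫ y, - (ph ((g y - s) / η) / η) ∂(stdGaussian E)) s := by
    intro s
    refine (hasDerivAt_integral_of_dominated_loc_of_deriv_le (s := univ) (bound := fun _ => η⁻¹)
      (F' := fun s y => - (ph ((g y - s) / η) / η))
      univ_mem (Eventually.of_forall fun s => (hcont s).aestronglyMeasurable)
      (integral_mem (hcont s) (fun y => Ph_mem _)).1
      ((hcont' s).div_const η).neg.aestronglyMeasurable ?_ (integrable_const _) ?_).2
    · refine Eventually.of_forall fun y s _ => ?_
      rw [norm_neg, Real.norm_eq_abs, abs_of_pos (div_pos (ph_pos _) hη), div_eq_mul_inv]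
      exact mul_le_of_le_one_left (by positivity) (ph_le_one _)
    · refine Eventually.of_forall fun y s _ => ?_
      have h1 : HasDerivAt (fun s : ℝ => (g y - s) / η) (-1 / η) s := by
        simpa using ((hasDerivAt_id s).const_sub (g y)).div_const η
      have := (hasDerivAt_Ph ((g y - s) / η)).comp s h1
      convert! this using 1
      ring
  have hB : ∀ s, II (v s) ≤ √(1 + η ^ 2) * ∫ y, ph ((g y - s) / η) / η ∂(stdGaussian E) := by
    intro s
    have hfc : ContDiff ℝ 2 (fun y => Ph ((g y - s) / η)) :=
      Ph_contDiff.comp ((hg.sub contDiff_const).div_const η)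
    have hsupp : HasCompactSupport (fderiv ℝ (fun y => Ph ((g y - s) / η))) := by
      have h0 : HasCompactSupport (fun y => Ph ((g y - s) / η) - Ph ((c - s) / η)) := by
        have := hc.comp_left (g := fun t => Ph ((t + c - s) / η) - Ph ((c - s) / η)) (by simp)
        convert! this using 2
        simp
      have := h0.fderiv (𝕜 := ℝ)
      have e : fderiv ℝ (fun y => Ph ((g y - s) / η) - Ph ((c - s) / η)) =
          fderiv ℝ (fun y => Ph ((g y - s) / η)) := by
        ext1 y; exact fderiv_sub_const _
      rwa [e] at this
    have hf' : ContDiff ℝ 1 (fderiv ℝ (fun y => Ph ((g y - s) / η))) :=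
      hfc.fderiv_right (by norm_num)
    obtain ⟨K, hK⟩ := ContDiff.lipschitzWith_of_hasCompactSupport hsupp hf' (by norm_num)
    obtain ⟨C, hC⟩ := hsupp.exists_bound_of_continuous hf'.continuous
    have hb := bobkov_gauss b (fun y => Ph ((g y - s) / η)) (fun y => Ph_mem _)
      (hfc.differentiable (by norm_num)) K hK C hC (hvm s)
    refine hb.trans ?_
    rw [← integral_const_mul]
    have hfd : ∀ y, fderiv ℝ (fun y => Ph ((g y - s) / η)) y =
        (ph ((g y - s) / η) * η⁻¹) • fderiv ℝ g y := by
      intro y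
      have h1 : HasFDerivAt (fun y => (g y - s) / η) (η⁻¹ • fderiv ℝ g y) y := by
        have := (((hg.differentiable (by norm_num)) y).hasFDerivAt.sub_const s).const_mul η⁻¹
        convert! this using 2
        ring
      have := (hasDerivAt_Ph ((g y - s) / η)).comp_hasFDerivAt y h1
      rw [smul_smul] at this
      exact this.fderiv
    refine integral_mono_of_nonneg (Eventually.of_forall fun y => Real.sqrt_nonneg _) ?_
      (Eventually.of_forall fun y => ?_)
    · refine Integrable.const_mul ?_ _
      refine Integrable.of_bound ((hcont' s).div_const η).aestronglyMeasurable η⁻¹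
        (Eventually.of_forall fun y => ?_)
      rw [Real.norm_eq_abs, abs_of_pos (div_pos (ph_pos _) hη), div_eq_mul_inv]
      exact mul_le_of_le_one_left (by positivity) (ph_le_one _)
    · simp only
      rw [sum_dual b, hfd, norm_smul, II, kk_Ph]
      have hp := ph_pos ((g y - s) / η)
      set p := ph ((g y - s) / η)
      rw [Real.sqrt_le_left (by positivity), mul_pow (√(1 + η ^ 2)), Real.sq_sqrt (by positivity)]
      rw [Real.norm_eq_abs, mul_pow, sq_abs]
      have h2 : ‖fderiv ℝ g y‖ ^ 2 ≤ 1 := pow_le_one₀ (norm_nonneg _) (hl y)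
      have h3 : (1 + η ^ 2) * (p / η) ^ 2 = p ^ 2 + (p * η⁻¹) ^ 2 := by field_simp; ring
      rw [h3]
      have := mul_le_of_le_one_right (sq_nonneg (p * η⁻¹)) h2
      linarith
  have hw : ∀ s, HasDerivAt (fun s => kk (v s))
      ((ph (kk (v s)))⁻¹ * ∫ y, - (ph ((g y - s) / η) / η) ∂(stdGaussian E)) s := fun s =>
    (hasDerivAt_kk (hvm s)).comp s (hvd s)
  have := image_sub_le_mul_sub_of_deriv_le (f := fun s => kk (v s)) (C := -(√(1 + η ^ 2))⁻¹)
    (fun s => (hw s).differentiableAt) (fun s => by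
      rw [(hw s).deriv, integral_neg, mul_neg, neg_le_neg_iff]
      have h1 := hB s
      have h2 : 0 < √(1 + η ^ 2) := by positivity
      have h3 := II_pos (v s)
      rw [II] at h1 h3
      rw [inv_mul_eq_div, le_div_iff₀ h3, inv_mul_le_iff₀ h2]
      exact h1) (x := s) (y := s + u) (by linarith)
  simp only [hv] at this
  linarith

end gauss2
end GB
namespace GB
open MeasureTheory ProbabilityTheory Filter Topology Set
set_option linter.unusedSectionVars false
section gauss3
variable {E : Type*} [NormedAddCommGroup E] [InnerProductSpace ℝ E] [FiniteDimensional ℝ E]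
  [MeasurableSpace E] [BorelSpace E] {ι : Type*} [Fintype ι]

open scoped Convolution in
lemma mollify (F : E → ℝ) (hF : LipschitzWith 1 F) (hc : HasCompactSupport F) {δ : ℝ} (hδ : 0 < δ) :
    ∃ g : E → ℝ, ContDiff ℝ 2 g ∧ HasCompactSupport g ∧ (∀ y, ‖fderiv ℝ g y‖ ≤ 1) ∧
      ∀ y, |g y - F y| ≤ δ := by
  let φ : ContDiffBump (0 : E) := ⟨δ / 2, δ, half_pos hδ, half_lt_self hδ⟩
  let ν : Measure E := Measure.addHaar
  let g : E → ℝ := (φ.normed ν ⋆[ContinuousLinearMap.lsmul ℝ ℝ, ν] F : E → ℝ)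
  have hFc : Continuous F := hF.continuous
  have hInteg : ∀ x, Integrable (fun t => φ.normed ν t • F (x - t)) ν := by
    intro x
    apply Continuous.integrable_of_hasCompactSupport
    · exact (φ.continuous_normed).smul (hFc.comp (by fun_prop))
    · exact φ.hasCompactSupport_normed.smul_right
  have hlip : LipschitzWith 1 g := by
    refine LipschitzWith.of_dist_le_mul fun x y => ?_
    rw [dist_eq_norm, NNReal.coe_one, one_mul]
    have : g x - g y = ∫ t, φ.normed ν t * (F (x - t) - F (y - t)) ∂ν := by
      change (∫ t, φ.normed ν t • F (x - t) ∂ν) - (∫ t, φ.normed ν t • F (y - t) ∂ν) = _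
      rw [← integral_sub (hInteg x) (hInteg y)]
      congr 1; ext t; simp only [smul_eq_mul]; ring
    rw [this]
    calc ‖∫ t, φ.normed ν t * (F (x - t) - F (y - t)) ∂ν‖
        ≤ ∫ t, φ.normed ν t * dist x y ∂ν := by
          refine norm_integral_le_of_norm_le (φ.integrable_normed.mul_const _)
            (Eventually.of_forall fun t => ?_)
          rw [norm_mul, Real.norm_eq_abs, abs_of_nonneg (φ.nonneg_normed t)]
          gcongr
          · exact φ.nonneg_normed t
          · rw [← dist_eq_norm]
            refine (hF.dist_le_mul _ _).trans ?_
            simp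
      _ = dist x y := by rw [integral_mul_const, φ.integral_normed, one_mul]
  refine ⟨g, ?_, ?_, ?_, ?_⟩
  · exact φ.hasCompactSupport_normed.contDiff_convolution_left _ φ.contDiff_normed
      hFc.locallyIntegrable
  · exact φ.hasCompactSupport_normed.convolution _ hc
  · intro y
    simpa using norm_fderiv_le_of_lipschitz ℝ (x₀ := y) hlip
  · intro y
    rw [← Real.dist_eq]
    refine φ.dist_normed_convolution_le hFc.aestronglyMeasurable fun x hx => ?_
    refine (hF.dist_le_mul _ _).trans ?_
    rw [NNReal.coe_one, one_mul]
    exact (Metric.mem_ball.1 hx).le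

lemma conc_step (F : E → ℝ) (c : ℝ) (hF : LipschitzWith 1 F)
    (hc : HasCompactSupport (fun y => F y - c)) (M : ℝ)
    (hM : 1 / 2 ≤ (stdGaussian E).real {y | F y ≤ M}) {η τ u : ℝ} (hη : 0 < η) (hτ : 0 < τ)
    (hu : 0 ≤ u) :
    (stdGaussian E).real {y | M + u + 2 * η + 2 * τ ≤ F y} * Ph (τ / η) ≤
      Ph (kk (1 / 2 + Ph (-(τ / η))) - (√(1 + η ^ 2))⁻¹ * u) := by
  have hFc := hF.continuous
  obtain ⟨g0, hg0, hgc, hgl, hgd⟩ := mollify (fun y => F y - c)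
    (LipschitzWith.of_dist_le_mul fun x y => by simpa using hF.dist_le_mul x y) hc hη
  let g : E → ℝ := fun y => g0 y + c
  have hg : ContDiff ℝ 2 g := hg0.add contDiff_const
  have hgcont := hg.continuous
  have h1 : ∀ y, |g y - F y| ≤ η := fun y => by
    have := hgd y
    rwa [show g0 y - (F y - c) = g y - F y by simp only [g]; ring] at this
  have h2 : ∀ y, ‖fderiv ℝ g y‖ ≤ 1 := fun y => by
    have : fderiv ℝ g y = fderiv ℝ g0 y := fderiv_add_const _
    rw [this]; exact hgl y
  have hsl := slope (stdOrthonormalBasis ℝ E) g hg c (by simpa [g] using hgc) h2 hη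
    (M + η + τ) u hu
  have hcont : ∀ s, Continuous (fun y => Ph ((g y - s) / η)) := fun s =>
    Ph_cont.comp (by fun_prop)
  have hI := fun s => integral_mem (hcont s) (fun y => Ph_mem _)
  have hr : Ph (-(τ / η)) < 1 / 2 := by
    rw [← Ph_zero]; exact Ph_strictMono (by simp; positivity)
  have hrp := Ph_pos (-(τ / η))
  have mA : MeasurableSet {y | F y ≤ M} := measurableSet_le hFc.measurable measurable_const
  have mB : MeasurableSet {y | M + u + 2 * η + 2 * τ ≤ F y} :=
    measurableSet_le measurable_const hFc.measurable
  have b1 : ∫ y, Ph ((g y - (M + η + τ)) / η) ∂(stdGaussian E) ≤ 1 / 2 + Ph (-(τ / η)) := by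
    have i1 : Integrable ({y | F y ≤ M}ᶜ.indicator (fun _ => (1:ℝ))) (stdGaussian E) :=
      (integrable_const _).indicator mA.compl
    calc _ ≤ ∫ y, (Ph (-(τ / η)) + {y | F y ≤ M}ᶜ.indicator (fun _ => (1:ℝ)) y) ∂(stdGaussian E) := by
          refine integral_mono (hI _).1 ((integrable_const _).add i1) fun y => ?_
          by_cases hy : F y ≤ M
          · simp only [mem_compl_iff, mem_ofPred_eq, hy, not_true_eq_false, not_false_eq_true,
              indicator_of_notMem, add_zero]
            apply Ph_strictMono.monotone
            rw [← neg_div]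
            gcongr
            have := abs_le.1 (h1 y)
            linarith
          · simp only [mem_compl_iff, mem_ofPred_eq, hy, not_false_eq_true, indicator_of_mem]
            have := Ph_lt_one ((g y - (M + η + τ)) / η)
            linarith
      _ = Ph (-(τ / η)) + (1 - (stdGaussian E).real {y | F y ≤ M}) := by
          rw [integral_add (integrable_const _) i1, integral_indicator mA.compl]
          simp [probReal_compl_eq_one_sub mA]
      _ ≤ _ := by linarith
  have b2 : (stdGaussian E).real {y | M + u + 2 * η + 2 * τ ≤ F y} * Ph (τ / η) ≤
      ∫ y, Ph ((g y - (M + η + τ + u)) / η) ∂(stdGaussian E) := by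
    calc _ = ∫ y, {y | M + u + 2 * η + 2 * τ ≤ F y}.indicator (fun _ => Ph (τ / η)) y
          ∂(stdGaussian E) := by
          rw [integral_indicator mB]; simp
      _ ≤ _ := by
          refine integral_mono ((integrable_const _).indicator mB) (hI _).1 fun y => ?_
          by_cases hy : M + u + 2 * η + 2 * τ ≤ F y
          · simp only [mem_ofPred_eq, hy, indicator_of_mem]
            apply Ph_strictMono.monotone
            gcongr
            have := abs_le.1 (h1 y)
            linarith
          · simp only [mem_ofPred_eq, hy, not_false_eq_true, indicator_of_notMem]
            exact (Ph_pos _).le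
  refine b2.trans ?_
  rw [← Ph_kk (hI (M + η + τ + u)).2]
  apply Ph_strictMono.monotone
  refine hsl.trans ?_
  have := (kk_strictMonoOn.monotoneOn) (hI (M + η + τ)).2 (b := 1 / 2 + Ph (-(τ / η)))
    ⟨by linarith, by linarith⟩ b1
  linarith

/-- Gaussian concentration about a median -/
lemma conc (F : E → ℝ) (c : ℝ) (hF : LipschitzWith 1 F)
    (hc : HasCompactSupport (fun y => F y - c)) (M : ℝ)
    (hM : 1 / 2 ≤ (stdGaussian E).real {y | F y ≤ M}) {u : ℝ} (hu : 0 < u) :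
    (stdGaussian E).real {y | M + u ≤ F y} ≤ Ph (-u) := by
  have key : ∀ w, 0 ≤ w → w < u → (stdGaussian E).real {y | M + u ≤ F y} ≤ Ph (-w) := by
    intro w hw hwu
    have t0 : Tendsto (fun n : ℕ => ((n:ℝ))⁻¹) atTop (𝓝 0) := tendsto_inv_atTop_nhds_zero_nat
    have tn : Tendsto (fun n : ℕ => (n:ℝ)) atTop atTop := tendsto_natCast_atTop_atTop
    have t1 : Tendsto (fun n : ℕ => (stdGaussian E).real {y | M + u ≤ F y} * Ph (n:ℝ)) atTop
        (𝓝 ((stdGaussian E).real {y | M + u ≤ F y} * 1)) := (Ph_atTop.comp tn).const_mul _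
    have t2 : Tendsto (fun n : ℕ => Ph (kk (1 / 2 + Ph (-(n:ℝ))) -
        (√(1 + (((n:ℝ))⁻¹ ^ 2) ^ 2))⁻¹ * w)) atTop (𝓝 (Ph (-w))) := by
      have hk : kk (1 / 2) = 0 := by rw [← Ph_zero, kk_Ph]
      refine (Ph_cont.tendsto _).comp ?_
      have a1 : Tendsto (fun n : ℕ => kk (1 / 2 + Ph (-(n:ℝ)))) atTop (𝓝 0) := by
        rw [← hk]
        refine ((kk_continuousAt ⟨by norm_num, by norm_num⟩).tendsto).comp ?_
        have := (Ph_atBot.comp (tendsto_neg_atTop_atBot.comp tn)).const_add (1 / 2 : ℝ)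
        rwa [add_zero] at this
      have a2 : Tendsto (fun n : ℕ => (√(1 + (((n:ℝ))⁻¹ ^ 2) ^ 2))⁻¹ * w) atTop (𝓝 w) := by
        have c : Continuous (fun x : ℝ => (√(1 + (x ^ 2) ^ 2))⁻¹ * w) := by
          refine (Continuous.inv₀ (by fun_prop) fun x => ?_).mul continuous_const
          positivity
        have := (c.tendsto 0).comp t0
        simpa only [Function.comp_def, ne_eq, OfNat.ofNat_ne_zero, not_false_eq_true, zero_pow,
          add_zero, Real.sqrt_one, inv_one, one_mul] using this
      simpa using a1.sub a2
    rw [mul_one] at t1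
    have t3 : Tendsto (fun n : ℕ => w + 2 * ((n:ℝ))⁻¹ ^ 2 + 2 * ((n:ℝ))⁻¹) atTop (𝓝 w) := by
      have c : Continuous (fun x : ℝ => w + 2 * x ^ 2 + 2 * x) := by fun_prop
      have := (c.tendsto 0).comp t0
      simpa only [Function.comp_def, ne_eq, OfNat.ofNat_ne_zero, not_false_eq_true, zero_pow,
          add_zero, mul_zero] using this
    refine le_of_tendsto_of_tendsto t1 t2 ?_
    filter_upwards [eventually_gt_atTop 0, t3.eventually_lt_const hwu] with n hn hlt
    have hnp : (0:ℝ) < n := by exact_mod_cast hn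
    have := conc_step F c hF hc M hM (η := ((n:ℝ))⁻¹ ^ 2) (τ := (n:ℝ)⁻¹) (u := w)
      (by positivity) (by positivity) hw
    rw [show ((n:ℝ))⁻¹ / (n:ℝ)⁻¹ ^ 2 = n by field_simp] at this
    refine le_trans ?_ this
    refine mul_le_mul_of_nonneg_right (measureReal_mono fun y hy => ?_) (Ph_pos _).le
    have hy' : M + u ≤ F y := hy
    change M + w + 2 * ((n:ℝ))⁻¹ ^ 2 + 2 * ((n:ℝ))⁻¹ ≤ F y
    linarith
  have t : Tendsto (fun w => Ph (-w)) (𝓝[<] u) (𝓝 (Ph (-u))) :=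
    ((Ph_cont.comp continuous_neg).tendsto u).mono_left nhdsWithin_le_nhds
  refine ge_of_tendsto t ?_
  filter_upwards [Ioo_mem_nhdsLT hu] with w hw using key w hw.1.le hw.2

lemma conc2 (F : E → ℝ) (hF : LipschitzWith 1 F) (hco : Tendsto F (cocompact E) atTop) (M : ℝ)
    (hM1 : 1 / 2 ≤ (stdGaussian E).real {y | F y ≤ M})
    (hM2 : 1 / 2 ≤ (stdGaussian E).real {y | M ≤ F y}) {u : ℝ} (hu : 0 < u) :
    (stdGaussian E).real {y | u ≤ |F y - M|} ≤ 2 * Ph (-u) := by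
  set L := M + u + 1 with hL
  have hlip : LipschitzWith 1 (fun y => min (F y) L) := by
    simpa using hF.min (LipschitzWith.const L)
  have hsup : HasCompactSupport (fun y => min (F y) L - L) := by
    obtain ⟨K, hK, hK2⟩ := mem_cocompact.1 (hco.eventually (eventually_ge_atTop L))
    refine HasCompactSupport.intro hK fun y hy => ?_
    have : L ≤ F y := hK2 hy
    rw [min_eq_right this, sub_self]
  have hsup2 : HasCompactSupport (fun y => -min (F y) L - -L) := by
    have := hsup.neg
    convert! this using 2
    simp only [Pi.neg_apply]
    ring
  have hlip2 : LipschitzWith 1 (fun y => -min (F y) L) := hlip.neg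
  have c1 := conc _ L hlip hsup M (by
    convert! hM1 using 3
    ext y
    simp only [min_le_iff]
    constructor
    · rintro (h | h)
      · exact h
      · linarith
    · exact Or.inl) hu
  have c2 := conc _ (-L) hlip2 hsup2 (-M) (by
    convert! hM2 using 3
    ext y
    simp only [neg_le_neg_iff, le_min_iff]
    exact ⟨fun h => h.1, fun h => ⟨h, by linarith⟩⟩) hu
  have : {y | u ≤ |F y - M|} ⊆ {y | M + u ≤ min (F y) L} ∪ {y | -M + u ≤ -min (F y) L} := by
    intro y hy
    have hy' : u ≤ |F y - M| := hy
    rcases le_abs.1 hy' with h | h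
    · left
      change M + u ≤ min (F y) L
      exact le_min (by linarith) (by linarith)
    · right
      have := min_le_left (F y) L
      change -M + u ≤ -min (F y) L
      linarith
  have h3 := (measureReal_mono (μ := stdGaussian E) this).trans (measureReal_union_le _ _)
  linarith

end gauss3
end GB
namespace GB
open MeasureTheory ProbabilityTheory Filter Topology Set
set_option linter.unusedSectionVars false

lemma exp_layer {a t x : ℝ} (ha : 0 < a) (ht : 1 < t) :
    t ≤ Real.exp (a / 2 * x ^ 2) ↔ √(2 * Real.log t / a) ≤ |x| := by
  have hl := Real.log_pos ht
  rw [Real.sqrt_le_left (abs_nonneg _), sq_abs, div_le_iff₀ ha,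
    ← Real.log_le_iff_le_exp (by linarith)]
  constructor <;> intro h <;> linarith

lemma gauss_abs {u : ℝ} (hu : 0 < u) :
    (gaussianReal 0 1).real {x | u ≤ |x|} = 2 * Ph (-u) := by
  have : {x : ℝ | u ≤ |x|} = Iic (-u) ∪ Ici u := by
    ext x
    simp only [mem_ofPred_eq, le_abs, mem_union, mem_Iic, mem_Ici]
    constructor
    · rintro (h | h)
      · exact Or.inr h
      · left; linarith
    · rintro (h | h)
      · right; linarith
      · exact Or.inl h
  rw [this, measureReal_union _ measurableSet_Ici, gauss_Ici, Ph]
  · ring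
  · rw [Set.disjoint_left]
    intro x hx hx'
    simp only [mem_Iic, mem_Ici] at hx hx'
    linarith

lemma gauss_exp {a : ℝ} (ha1 : a < 1) :
    ∫⁻ x, ENNReal.ofReal (Real.exp (a / 2 * x ^ 2)) ∂(gaussianReal 0 1) =
      ENNReal.ofReal (1 / √(1 - a)) := by
  have h1a : 0 < 1 - a := by linarith
  rw [gaussianReal_of_var_ne_zero _ one_ne_zero,
    lintegral_withDensity_eq_lintegral_mul _ (measurable_gaussianPDF 0 1) (by fun_prop)]
  have e : ∀ x : ℝ, (gaussianPDF 0 1 * fun x => ENNReal.ofReal (Real.exp (a / 2 * x ^ 2))) x =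
      ENNReal.ofReal ((√(2 * Real.pi))⁻¹ * Real.exp (-((1 - a) / 2) * x ^ 2)) := by
    intro x
    rw [Pi.mul_apply, gaussianPDF, ← ENNReal.ofReal_mul (gaussianPDFReal_nonneg _ _ _), pdf_eq, ph,
      mul_assoc, ← Real.exp_add]
    congr 3; ring
  simp_rw [e]
  rw [← ofReal_integral_eq_lintegral_ofReal ((integrable_exp_neg_mul_sq (by positivity)).const_mul _)
    (Eventually.of_forall fun x => by positivity), integral_const_mul, integral_gaussian]
  congr 1
  rw [show Real.pi / ((1 - a) / 2) = (2 * Real.pi) / (1 - a) by field_simp,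
    Real.sqrt_div (by positivity)]
  have : 0 < √(2 * Real.pi) := by positivity
  field_simp

lemma dom {Ω : Type*} [MeasurableSpace Ω] (μ : Measure Ω) [IsProbabilityMeasure μ] (X : Ω → ℝ)
    (hX : Measurable X) (h : ∀ u, 0 < u → μ.real {y | u ≤ |X y|} ≤ 2 * Ph (-u)) {a : ℝ}
    (ha : 0 < a) (ha1 : a < 1) :
    ∫⁻ y, ENNReal.ofReal (Real.exp (a / 2 * (X y) ^ 2)) ∂μ ≤ ENNReal.ofReal (1 / √(1 - a)) := by
  rw [← gauss_exp ha1, lintegral_eq_lintegral_meas_le μ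
    (Eventually.of_forall fun y => (Real.exp_pos _).le) (by fun_prop),
    lintegral_eq_lintegral_meas_le (gaussianReal 0 1)
    (Eventually.of_forall fun y => (Real.exp_pos _).le) (by fun_prop)]
  refine lintegral_mono fun t => ?_
  rcases le_or_gt t 1 with ht | ht
  · have : {x : ℝ | t ≤ Real.exp (a / 2 * x ^ 2)} = univ :=
      eq_univ_of_forall fun x => ht.trans (Real.one_le_exp (by positivity))
    rw [this, measure_univ]
    exact prob_le_one
  · have hu : 0 < √(2 * Real.log t / a) := Real.sqrt_pos.2 (by have := Real.log_pos ht; positivity)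
    simp only [exp_layer ha ht]
    rw [← ENNReal.toReal_le_toReal (measure_ne_top _ _) (measure_ne_top _ _)]
    change μ.real _ ≤ (gaussianReal 0 1).real _
    rw [gauss_abs hu]
    exact h _ hu

end GB
namespace GB
open MeasureTheory ProbabilityTheory Filter Topology Set
set_option linter.unusedSectionVars false
section lp
variable {T : Type*} [Fintype T]

/-- the `ℓ^p` norm -/
noncomputable def NN (p : ℝ) (z : T → ℝ) : ℝ := (∑ x, |z x| ^ p) ^ (1 / p)

lemma NN_nonneg (p : ℝ) (z : T → ℝ) : 0 ≤ NN p z := by unfold NN; positivity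

lemma NN_cont {p : ℝ} (hp : 1 ≤ p) : Continuous (NN p : (T → ℝ) → ℝ) := by
  unfold NN
  refine Continuous.rpow_const (continuous_finsetSum _ fun x _ => ?_) fun _ => Or.inr (by positivity)
  exact Continuous.rpow_const (by fun_prop) fun _ => Or.inr (by positivity)

lemma NN_neg (p : ℝ) (z : T → ℝ) : NN p (-z) = NN p z := by simp [NN]

lemma NN_sub {p : ℝ} (hp : 1 ≤ p) (z w : T → ℝ) : |NN p z - NN p w| ≤ NN p (z - w) := by
  have h1 := Real.Lp_add_le Finset.univ (z - w) w hp
  have h2 := Real.Lp_add_le Finset.univ (w - z) z hp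
  have e := NN_neg p (z - w)
  rw [neg_sub] at e
  simp only [Pi.sub_apply, sub_add_cancel] at h1 h2
  simp only [NN, Pi.sub_apply] at e ⊢
  rw [abs_le]
  constructor <;> linarith

lemma le_NN {p : ℝ} (hp : 1 ≤ p) (z : T → ℝ) : ‖z‖ ≤ NN p z := by
  rw [pi_norm_le_iff_of_nonneg (NN_nonneg p z)]
  intro x
  have hp0 : 0 < p := by linarith
  have h1 : |z x| ^ p ≤ ∑ x, |z x| ^ p :=
    Finset.single_le_sum (f := fun x => |z x| ^ p) (fun j _ => by positivity) (Finset.mem_univ x)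
  have h2 := Real.rpow_le_rpow (by positivity) h1 (by positivity : 0 ≤ 1 / p)
  rw [← Real.rpow_mul (abs_nonneg _), mul_one_div_cancel hp0.ne', Real.rpow_one] at h2
  exact h2

lemma NN_dual {p : ℝ} (hp : 1 < p) (z : T → ℝ) (hz : NN p z ≠ 0) :
    ∃ f : T → ℝ, (∑ x, |f x| ^ (p / (p - 1))) ^ ((p - 1) / p) = 1 ∧ ∑ x, f x * z x = NN p z := by
  set S := ∑ x, |z x| ^ p with hS
  have hS0 : 0 ≤ S := by positivity
  have hSp : 0 < S := by
    refine lt_of_le_of_ne hS0 fun h => hz ?_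
    rw [NN, ← hS, ← h, Real.zero_rpow (by positivity)]
  have hp1 : 0 < p - 1 := by linarith
  have hp0 : 0 < p := by linarith
  have habs : ∀ x, |(SignType.sign (z x) : ℝ) * (|z x| ^ (p - 1) / S ^ ((p - 1) / p))| =
      |z x| ^ (p - 1) / S ^ ((p - 1) / p) := by
    intro x
    rcases eq_or_ne (z x) 0 with h | h
    · simp [h, Real.zero_rpow hp1.ne']
    · rw [abs_mul, abs_of_nonneg (a := _ / _) (by positivity)]
      rcases lt_or_gt_of_ne h with h | h <;> simp [h]
  refine ⟨fun x => SignType.sign (z x) * (|z x| ^ (p - 1) / S ^ ((p - 1) / p)), ?_, ?_⟩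
  · have : ∀ x, |(SignType.sign (z x) : ℝ) * (|z x| ^ (p - 1) / S ^ ((p - 1) / p))| ^ (p / (p - 1)) =
        |z x| ^ p / S := by
      intro x
      rw [habs, Real.div_rpow (by positivity) (by positivity), ← Real.rpow_mul (abs_nonneg _),
        ← Real.rpow_mul hS0, show (p - 1) * (p / (p - 1)) = p by field_simp,
        show (p - 1) / p * (p / (p - 1)) = 1 by field_simp, Real.rpow_one]
    simp only [this, ← Finset.sum_div]
    rw [← hS, div_self hSp.ne', Real.one_rpow]
  · have : ∀ x, (SignType.sign (z x) : ℝ) * (|z x| ^ (p - 1) / S ^ ((p - 1) / p)) * z x =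
        |z x| ^ p / S ^ ((p - 1) / p) := by
      intro x
      rcases eq_or_ne (z x) 0 with h | h
      · simp [h, Real.zero_rpow hp0.ne']
      · have h1 : |z x| ^ p = |z x| ^ (p - 1) * |z x| := by
          rw [Real.rpow_sub_one (abs_ne_zero.2 h), div_mul_cancel₀ _ (abs_ne_zero.2 h)]
        rw [h1, ← sign_mul_self (z x)]; ring
    simp only [this, ← Finset.sum_div]
    rw [← hS, NN, ← hS, div_eq_iff (by positivity), ← Real.rpow_add hSp,
      show 1 / p + (p - 1) / p = 1 by field_simp; ring, Real.rpow_one]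

open scoped Matrix in
lemma NN_lip {p : ℝ} (hp : 1 < p) (G : Matrix T T ℝ)
    (B : EuclideanSpace ℝ T →L[ℝ] EuclideanSpace ℝ T)
    (hB : ∀ x y, inner ℝ x (B y) = inner ℝ (B x) y)
    (hG : ∀ x, inner ℝ (B x) (B x) = (WithLp.ofLp x) ⬝ᵥ (G *ᵥ (WithLp.ofLp x))) (ρ : ℝ)
    (hρ : ∀ f : T → ℝ, (∑ x, |f x| ^ (p / (p - 1))) ^ ((p - 1) / p) = 1 → f ⬝ᵥ (G *ᵥ f) ≤ ρ)
    (x : EuclideanSpace ℝ T) : NN p (WithLp.ofLp (B x)) ≤ √ρ * ‖x‖ := by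
  by_cases h : NN p (WithLp.ofLp (B x)) = 0
  · rw [h]; positivity
  obtain ⟨f, hf, hfz⟩ := NN_dual hp _ h
  rw [← hfz]
  have h1 : ∑ i, f i * (WithLp.ofLp (B x)) i = inner ℝ (WithLp.toLp 2 f) (B x) := by
    simp [PiLp.inner_apply, mul_comm]
  rw [h1, hB]
  refine (real_inner_le_norm _ _).trans ?_
  gcongr
  apply Real.le_sqrt_of_sq_le
  rw [← real_inner_self_eq_norm_sq, hG]
  exact hρ f hf

end lp
end GB
namespace GB
open MeasureTheory ProbabilityTheory Filter Topology Set
set_option linter.unusedSectionVars false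
section law
variable {T : Type*} [Fintype T]

open scoped Matrix MatrixOrder in
lemma law {Ω : Type*} [MeasurableSpace Ω] (P : Measure Ω) [IsProbabilityMeasure P]
    (G : Matrix T T ℝ) (hpd : G.PosDef) (Z : Ω → T → ℝ)
    (hZ : ∀ f : T → ℝ,
      P.map (fun ω => ∑ x : T, f x * Z ω x) = gaussianReal 0 (Real.toNNReal (f ⬝ᵥ (G *ᵥ f)))) :
    ∃ B : EuclideanSpace ℝ T →L[ℝ] EuclideanSpace ℝ T,
      (∀ x y, inner ℝ x (B y) = inner ℝ (B x) y) ∧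
      (∀ x, inner ℝ (B x) (B x) = (WithLp.ofLp x) ⬝ᵥ (G *ᵥ (WithLp.ofLp x))) ∧
      AEMeasurable (fun ω => WithLp.toLp 2 (Z ω)) P ∧
      P.map (fun ω => WithLp.toLp 2 (Z ω)) = (stdGaussian (EuclideanSpace ℝ T)).map B := by
  classical
  have hS : G.PosSemidef := hpd.posSemidef
  set B : EuclideanSpace ℝ T →L[ℝ] EuclideanSpace ℝ T :=
    Matrix.toEuclideanCLM (𝕜 := ℝ) (CFC.sqrt G) with hBdef
  have hsa : IsSelfAdjoint B := (CFC.sqrt_nonneg G).isSelfAdjoint.map _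
  have hB : ∀ x y, inner ℝ x (B y) = inner ℝ (B x) y := by
    intro x y
    rw [← ContinuousLinearMap.adjoint_inner_left, hsa.adjoint_eq]
  have hBm : AEMeasurable (fun ω => WithLp.toLp 2 (Z ω)) P := by
    have h : ∀ x, AEMeasurable (fun ω => Z ω x) P := by
      intro x
      have := hZ (Pi.single x 1)
      have h2 : (fun ω => ∑ y : T, (Pi.single x 1 : T → ℝ) y * Z ω y) = fun ω => Z ω x := by
        ext ω; simp [Pi.single_apply]
      rw [h2] at this
      refine AEMeasurable.of_map_ne_zero ?_
      rw [this]
      exact IsProbabilityMeasure.ne_zero _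
    have h3 : AEMeasurable Z P := aemeasurable_pi_iff.2 h
    exact (WithLp.measurable_toLp 2 _).comp_aemeasurable h3
  refine ⟨B, hB, ?_, hBm, ?_⟩
  · intro x
    rw [← hB, ← ContinuousLinearMap.comp_apply, ← ContinuousLinearMap.mul_def, hBdef, ← map_mul,
      CFC.sqrt_mul_sqrt_self _ hS.nonneg, Matrix.inner_toEuclideanCLM]
  · have e : (stdGaussian (EuclideanSpace ℝ T)).map B = multivariateGaussian 0 G := by
      rw [multivariateGaussian]; simp [hBdef]
    rw [e]
    have : IsProbabilityMeasure (P.map (fun ω => WithLp.toLp 2 (Z ω))) :=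
      Measure.isProbabilityMeasure_map hBm
    apply Measure.ext_of_charFun
    ext t
    rw [charFun_multivariateGaussian hS]
    have h1 : charFun (P.map (fun ω => WithLp.toLp 2 (Z ω))) t =
        charFun (P.map (fun ω => ∑ x : T, t x * Z ω x)) 1 := by
      have hm2 : AEMeasurable (fun ω => ∑ x : T, t x * Z ω x) P := by
        refine AEMeasurable.of_map_ne_zero ?_
        rw [hZ (fun x => t x)]
        exact IsProbabilityMeasure.ne_zero _
      rw [charFun_apply, charFun_apply, integral_map hBm (by fun_prop),
        integral_map hm2 (by fun_prop)]
      congr 1; ext ω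
      simp [PiLp.inner_apply]
    rw [h1, hZ (fun x => t x), charFun_gaussianReal]
    have h0 : 0 ≤ (fun x => t x) ⬝ᵥ (G *ᵥ (fun x => t x)) := by
      simpa using hS.dotProduct_mulVec_nonneg (fun x => t x)
    rw [Real.coe_toNNReal _ h0]
    simp

end law
end GB
open MeasureTheory ProbabilityTheory Matrix Real

/-- Exponential moment bound for the squared `ℓ^{2q}` norm of a centered Gaussian
vector via concentration around the median: if `M` is a median of `‖Z‖_{2q}`,
`ρ = sup{Var(∑ f_x Z_x) : ‖f‖_{(2q)'}=1}` and `γ(1+ε) < 1/ρ`, then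
`E[exp((γ/2)‖Z‖_{2q}²)] ≤ (−1 + 2/√(1−γ(1+ε)ρ)) · exp((γ/2)((1+ε)/ε)M²)`. -/
theorem gaussian_vector_exp_moment_bound
    {Ω : Type*} [MeasurableSpace Ω] (P : Measure Ω) [IsProbabilityMeasure P]
    {T : Type*} [Fintype T] [Nonempty T]
    (G : Matrix T T ℝ) (hpd : G.PosDef)
    (Z : Ω → T → ℝ)
    (hZ : ∀ f : T → ℝ,
      P.map (fun ω => ∑ x : T, f x * Z ω x) = gaussianReal 0 (Real.toNNReal (f ⬝ᵥ (G *ᵥ f))))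
    (q : ℝ) (hq : 1 ≤ q) (M : ℝ)
    (hM_ge : 1/2 ≤ P {ω | M ≤ (∑ x : T, |Z ω x| ^ (2 * q)) ^ (1 / (2 * q))})
    (hM_le : 1/2 ≤ P {ω | (∑ x : T, |Z ω x| ^ (2 * q)) ^ (1 / (2 * q)) ≤ M})
    (ρ : ℝ)
    (hρ : ρ = sSup {s : ℝ | ∃ f : T → ℝ,
        (∑ x : T, |f x| ^ (2 * q / (2 * q - 1))) ^ ((2 * q - 1) / (2 * q)) = 1 ∧
        s = f ⬝ᵥ (G *ᵥ f)})
    (γ ε : ℝ) (hγ : 0 < γ) (hε : 0 < ε) (hsmall : γ * (1 + ε) < 1 / ρ) :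
    ∫ ω, Real.exp (γ / 2 * ((∑ x : T, |Z ω x| ^ (2 * q)) ^ (1 / (2 * q))) ^ 2) ∂P
      ≤ (-1 + 2 / Real.sqrt (1 - γ * (1 + ε) * ρ))
          * Real.exp (γ / 2 * ((1 + ε) / ε) * M ^ 2) := by
  classical
  obtain ⟨B, hB, hBG, hWm, hlaw⟩ := GB.law P G hpd Z hZ
  set p : ℝ := 2 * q with hp
  have hp1 : 1 < p := by linarith
  have hγε : 0 < γ * (1 + ε) := by positivity
  have hρ0 : 0 < ρ := one_div_pos.1 (hγε.trans hsmall)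
  have hbdd : ∀ f : T → ℝ, (∑ x, |f x| ^ (p / (p - 1))) ^ ((p - 1) / p) = 1 →
      f ⬝ᵥ (G *ᵥ f) ≤ ρ := by
    intro f hf
    rw [hρ]
    refine le_csSup ?_ ⟨f, hf, rfl⟩
    by_contra hcon
    rw [Real.sSup_of_not_bddAbove hcon] at hρ
    exact hρ0.ne' hρ
  have hsr : 0 < √ρ := Real.sqrt_pos.2 hρ0
  have hcN : Continuous (fun z : EuclideanSpace ℝ T => GB.NN p (WithLp.ofLp z)) :=
    (GB.NN_cont hp1.le).comp (PiLp.continuous_ofLp 2 _)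
  set F : EuclideanSpace ℝ T → ℝ := fun y => GB.NN p (WithLp.ofLp (B y)) / √ρ with hF
  have hFlip : LipschitzWith 1 F := by
    refine LipschitzWith.of_dist_le_mul fun x y => ?_
    rw [NNReal.coe_one, one_mul, Real.dist_eq, hF]
    simp only
    rw [← sub_div, abs_div, abs_of_pos hsr, div_le_iff₀ hsr, dist_eq_norm, mul_comm]
    refine (GB.NN_sub hp1.le _ _).trans ?_
    have := GB.NN_lip hp1 G B hB hBG ρ hbdd (x - y)
    rwa [map_sub] at this
  have hBinj : Function.Injective B := by
    rw [injective_iff_map_eq_zero]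
    intro x hx
    by_contra hne
    have h1 := hBG x
    rw [hx, inner_zero_left] at h1
    have h2 : WithLp.ofLp x ≠ 0 := fun h => hne (by ext i; exact congrFun h i)
    have h3 := hpd.dotProduct_mulVec_pos h2
    simp only [star_trivial] at h3
    linarith
  have hco : Filter.Tendsto F (Filter.cocompact _) Filter.atTop := by
    have hce : Topology.IsClosedEmbedding B :=
      LinearMap.isClosedEmbedding_of_injective (f := B.toLinearMap) (LinearMap.ker_eq_bot.2 hBinj)
    have h2 : Topology.IsClosedEmbedding (fun y => WithLp.ofLp (B y)) :=
      (PiLp.homeomorph 2 (fun _ : T => ℝ)).isClosedEmbedding.comp hce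
    have h3 := (tendsto_norm_cocompact_atTop (E := T → ℝ)).comp h2.tendsto_cocompact
    refine (Filter.tendsto_atTop_mono (fun y => ?_) h3).atTop_div_const hsr
    exact GB.le_NN hp1.le _
  -- transfer of sets
  have hset : ∀ s : Set ℝ, MeasurableSet s →
      P {ω | GB.NN p (Z ω) ∈ s} = stdGaussian (EuclideanSpace ℝ T) {y | GB.NN p (WithLp.ofLp (B y)) ∈ s} := by
    intro s hs
    have hms : MeasurableSet ((fun z : EuclideanSpace ℝ T => GB.NN p (WithLp.ofLp z)) ⁻¹' s) :=
      hcN.measurable hs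
    have := congrArg (fun m => m ((fun z : EuclideanSpace ℝ T => GB.NN p (WithLp.ofLp z)) ⁻¹' s)) hlaw
    simp only at this
    rw [Measure.map_apply_of_aemeasurable hWm hms,
      Measure.map_apply B.continuous.measurable hms] at this
    exact this
  have half : ∀ s : Set (EuclideanSpace ℝ T), 1 / 2 ≤ stdGaussian (EuclideanSpace ℝ T) s →
      1 / 2 ≤ (stdGaussian (EuclideanSpace ℝ T)).real s := by
    intro s hs
    have := ENNReal.toReal_mono (measure_ne_top _ _) hs
    simpa [measureReal_def] using this
  have m1 : 1 / 2 ≤ (stdGaussian (EuclideanSpace ℝ T)).real {y | F y ≤ M / √ρ} := by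
    apply half
    have := hset (Set.Iic M) measurableSet_Iic
    change 1 / 2 ≤ P {ω | GB.NN p (Z ω) ∈ Set.Iic M} at hM_le
    rw [this] at hM_le
    convert! hM_le using 3
    ext y
    exact div_le_div_iff_of_pos_right hsr
  have m2 : 1 / 2 ≤ (stdGaussian (EuclideanSpace ℝ T)).real {y | M / √ρ ≤ F y} := by
    apply half
    have := hset (Set.Ici M) measurableSet_Ici
    change 1 / 2 ≤ P {ω | GB.NN p (Z ω) ∈ Set.Ici M} at hM_ge
    rw [this] at hM_ge
    convert! hM_ge using 3
    ext y
    exact div_le_div_iff_of_pos_right hsr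
  set a := γ * (1 + ε) * ρ with ha
  have ha0 : 0 < a := by positivity
  have ha1 : a < 1 := (lt_div_iff₀ hρ0).1 hsmall
  have hdom := GB.dom (stdGaussian (EuclideanSpace ℝ T)) (fun y => F y - M / √ρ)
    (hFlip.continuous.measurable.sub_const _)
    (fun u hu => GB.conc2 F hFlip hco _ m1 m2 hu) ha0 ha1
  have hI : ∫ ω, Real.exp (γ / 2 * ((∑ x : T, |Z ω x| ^ p) ^ (1 / p)) ^ 2) ∂P =
      ∫ y, Real.exp (γ / 2 * (GB.NN p (WithLp.ofLp (B y))) ^ 2) ∂(stdGaussian (EuclideanSpace ℝ T)) := by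
    have hc2 : Continuous (fun z : EuclideanSpace ℝ T =>
        Real.exp (γ / 2 * (GB.NN p (WithLp.ofLp z)) ^ 2)) := by fun_prop
    have e1 := integral_map hWm (f := fun z : EuclideanSpace ℝ T =>
        Real.exp (γ / 2 * (GB.NN p (WithLp.ofLp z)) ^ 2)) hc2.aestronglyMeasurable
    have e2 := integral_map (μ := stdGaussian (EuclideanSpace ℝ T)) B.continuous.measurable.aemeasurable
      (f := fun z : EuclideanSpace ℝ T =>
        Real.exp (γ / 2 * (GB.NN p (WithLp.ofLp z)) ^ 2)) hc2.aestronglyMeasurable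
    rw [hlaw, e2] at e1
    exact e1.symm
  rw [hI]
  set C := Real.exp (γ / 2 * ((1 + ε) / ε) * M ^ 2) with hC
  have hCp : 0 < C := Real.exp_pos _
  have hs1 : 0 < √(1 - a) := Real.sqrt_pos.2 (by linarith)
  have hs2 : √(1 - a) ≤ 1 := Real.sqrt_le_one.2 (by linarith)
  have hge1 : 1 ≤ 1 / √(1 - a) := (one_le_div hs1).2 hs2
  have hfin : ∫ y, Real.exp (γ / 2 * (GB.NN p (WithLp.ofLp (B y))) ^ 2)
      ∂(stdGaussian (EuclideanSpace ℝ T)) ≤ 1 / √(1 - a) * C := by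
    have hc3 : Continuous (fun y : EuclideanSpace ℝ T =>
        Real.exp (γ / 2 * (GB.NN p (WithLp.ofLp (B y))) ^ 2)) := by
      have := hcN.comp B.continuous
      simp only [Function.comp_def] at this
      fun_prop
    rw [integral_eq_lintegral_of_nonneg_ae (Filter.Eventually.of_forall fun y => (Real.exp_pos _).le)
      hc3.aestronglyMeasurable]
    refine ENNReal.toReal_le_of_le_ofReal (by positivity) ?_
    rw [ENNReal.ofReal_mul (by positivity)]
    refine le_trans ?_ (mul_le_mul_left hdom _)
    rw [← lintegral_mul_const' _ _ ENNReal.ofReal_ne_top]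
    refine lintegral_mono fun y => ?_
    rw [← ENNReal.ofReal_mul (Real.exp_pos _).le, hC, ← Real.exp_add]
    apply ENNReal.ofReal_le_ofReal
    apply Real.exp_le_exp.2
    have hFy : F y * √ρ = GB.NN p (WithLp.ofLp (B y)) := div_mul_cancel₀ _ hsr.ne'
    have hMy : M / √ρ * √ρ = M := div_mul_cancel₀ _ hsr.ne'
    set n := GB.NN p (WithLp.ofLp (B y)) with hn
    have h4 : a / 2 * (F y - M / √ρ) ^ 2 = γ / 2 * ((1 + ε) * (n - M) ^ 2) := by
      rw [← hFy]
      nth_rewrite 2 [← hMy]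
      rw [← sub_mul, mul_pow, Real.sq_sqrt hρ0.le, ha]
      ring
    rw [h4, mul_assoc, ← mul_add]
    refine mul_le_mul_of_nonneg_left ?_ (by positivity)
    have h5 : (1 + ε) * (n - M) ^ 2 + (1 + ε) / ε * M ^ 2 - n ^ 2 =
        (ε * (n - M) - M) ^ 2 / ε := by field_simp; ring
    have h6 : 0 ≤ (ε * (n - M) - M) ^ 2 / ε := by positivity
    linarith
  refine hfin.trans ?_
  refine mul_le_mul_of_nonneg_right ?_ hCp.le
  have : 2 / √(1 - a) = 1 / √(1 - a) + 1 / √(1 - a) := by ring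
  linarith
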